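/- Let S ⊂ ℤ_{≥0}^r be a good semigroup with symmetric weight function w (i.e., w(c−ℓ) = w(ℓ) on R(0,c), the Gorenstein case), with multiplicity vector m and conductor c. If p ∈ S is a local minimum point of w with 2m ≤ p ≤ c − 2m, then w(p) ≤ w(m). -/

import Mathlib

open Finset

/-- Lattice points (we work in `ℤ^r`; nonnegativity is imposed via hypotheses). -/
abbrev Pt (r : ℕ) := Fin r → ℤ

/-- The `i`-th standard basis vector. -/
def E {r : ℕ} (i : Fin r) : Pt r := Pi.single i 1

/-- `e_K = ∑_{i ∈ K} e_i`. -/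
def eK {r : ℕ} (K : Finset (Fin r)) : Pt r := ∑ i ∈ K, E i

/-- `Δ̄ᵢ(ℓ) = {s ∈ S : sᵢ = ℓᵢ, sⱼ ≥ ℓⱼ ∀ j ≠ i}`. -/
def DeltaBarI {r : ℕ} (S : Set (Pt r)) (ℓ : Pt r) (i : Fin r) : Set (Pt r) :=
  {s | s ∈ S ∧ s i = ℓ i ∧ ∀ j, j ≠ i → ℓ j ≤ s j}

/-- `Δᵢ(ℓ) = {s ∈ S : sᵢ = ℓᵢ, sⱼ > ℓⱼ ∀ j ≠ i}`. -/
def DeltaI {r : ℕ} (S : Set (Pt r)) (ℓ : Pt r) (i : Fin r) : Set (Pt r) :=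
  {s | s ∈ S ∧ s i = ℓ i ∧ ∀ j, j ≠ i → ℓ j < s j}

/-- `Δ(ℓ) = ∪ᵢ Δᵢ(ℓ)`. -/
def Delta {r : ℕ} (S : Set (Pt r)) (ℓ : Pt r) : Set (Pt r) := ⋃ i, DeltaI S ℓ i

/-- A good (local) semigroup `S ⊂ ℤ_{≥0}^r` with conductor `c`. -/
structure GoodSemigroup (r : ℕ) where
  S : Set (Pt r)
  c : Pt r
  nonneg : ∀ s ∈ S, (0 : Pt r) ≤ s
  zero_mem : (0 : Pt r) ∈ S
  add_mem : ∀ s ∈ S, ∀ t ∈ S, s + t ∈ S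
  coord_zero : ∀ s ∈ S, ∀ i, s i = 0 → s = 0
  min_mem : ∀ s ∈ S, ∀ t ∈ S, s ⊓ t ∈ S
  prop3 : ∀ s ∈ S, ∀ t ∈ S, ∀ i, s i = t i →
    ∃ u ∈ S, s ⊓ t ≤ u ∧ s i < u i ∧ ∀ j, j ≠ i → s j ≠ t j → u j = (s ⊓ t) j
  conductor_nonneg : (0 : Pt r) ≤ c
  conductor_mem : ∀ ℓ : Pt r, c ≤ ℓ → ℓ ∈ S
  conductor_min : ∀ c' : Pt r, 0 ≤ c' → (∀ ℓ, c' ≤ ℓ → ℓ ∈ S) → c ≤ c'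

/-- `h` is the (combinatorial) Hilbert function of the good semigroup `G`. -/
def IsHilbert {r : ℕ} (G : GoodSemigroup r) (h : Pt r → ℤ) : Prop :=
  h 0 = 0 ∧ ∀ ℓ : Pt r, 0 ≤ ℓ → ∀ i : Fin r,
    (h (ℓ + E i) = h ℓ + 1 ↔ (DeltaBarI G.S ℓ i).Nonempty) ∧
    (h (ℓ + E i) = h ℓ ↔ ¬ (DeltaBarI G.S ℓ i).Nonempty)

/-- `w` is the weight function of the good semigroup `G` (i.e. `w(ℓ) = 2h(ℓ) − |ℓ|`),
characterized by `w(0) = 0` and the step property. -/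
def IsWeight {r : ℕ} (G : GoodSemigroup r) (w : Pt r → ℤ) : Prop :=
  w 0 = 0 ∧ ∀ ℓ : Pt r, 0 ≤ ℓ → ∀ i : Fin r,
    (w (ℓ + E i) = w ℓ + 1 ↔ (DeltaBarI G.S ℓ i).Nonempty) ∧
    (w (ℓ + E i) = w ℓ - 1 ↔ ¬ (DeltaBarI G.S ℓ i).Nonempty)

/-- Generalized local minimum point of the weight function. -/
def GLM {r : ℕ} (w : Pt r → ℤ) (p : Pt r) : Prop :=
  0 ≤ p ∧ ∀ i : Fin r, 1 ≤ p i → w p < w (p - E i)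

/-- Local minimum point of the weight function. -/
def LocMin {r : ℕ} (w : Pt r → ℤ) (p : Pt r) : Prop :=
  GLM w p ∧ ∀ i : Fin r, w p < w (p + E i)

theorem E_same {r : ℕ} (i : Fin r) : (E i : Pt r) i = 1 := by simp [E]

theorem E_ne {r : ℕ} {i j : Fin r} (h : j ≠ i) : (E i : Pt r) j = 0 := by simp [E, h]

theorem E_nonneg {r : ℕ} (i : Fin r) : (0 : Pt r) ≤ E i := Pi.single_nonneg.2 zero_le_one

theorem add_E_le {r : ℕ} {a b : Pt r} (hab : a ≤ b) {i : Fin r} (hi : a i < b i) :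
    a + E i ≤ b := by
  intro j
  rcases eq_or_ne j i with rfl | hj
  · simpa [E_same] using hi
  · simpa [E_ne hj] using hab j

/-- A function that does not decrease along unit steps inside a box is at least as large at the
upper corner as at the lower one. -/
theorem le_of_unit_steps {r : ℕ} (f : Pt r → ℤ) {a b : Pt r} (hab : a ≤ b)
    (hf : ∀ ℓ, a ≤ ℓ → ∀ i, ℓ + E i ≤ b → f ℓ ≤ f (ℓ + E i)) : f a ≤ f b := by
  obtain ⟨n, hn⟩ : ∃ n : ℕ, ∑ i, (b i - a i) = n :=
    ⟨_, (Int.toNat_of_nonneg (Finset.sum_nonneg fun i _ => sub_nonneg.2 (hab i))).symm⟩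
  induction n generalizing a with
  | zero =>
    have h := (Finset.sum_eq_zero_iff_of_nonneg fun i _ => sub_nonneg.2 (hab i)).1
      (by simpa using hn)
    have hba : b = a := funext fun i => sub_eq_zero.1 (h i (Finset.mem_univ i))
    rw [hba]
  | succ n ih =>
    obtain ⟨i, -, hi⟩ : ∃ i ∈ Finset.univ, 0 < b i - a i := by
      apply Finset.exists_lt_of_sum_lt
      simp only [Finset.sum_const_zero, hn]
      positivity
    have hle := add_E_le hab (sub_pos.1 hi)
    refine (hf a le_rfl i hle).trans (ih hle ?_ ?_)
    · exact fun ℓ hℓ => hf ℓ ((le_add_of_nonneg_right (E_nonneg i)).trans hℓ)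
    · have hE : ∑ j, (E i : Pt r) j = 1 := by simp [E]
      simp only [Pi.add_apply, ← sub_sub, Finset.sum_sub_distrib, hE] at hn ⊢
      push_cast at hn
      linarith

theorem IsWeight.step {r : ℕ} {G : GoodSemigroup r} {w : Pt r → ℤ} (hw : IsWeight G w)
    {ℓ : Pt r} (hℓ : 0 ≤ ℓ) (i : Fin r) :
    (DeltaBarI G.S ℓ i).Nonempty ∧ w (ℓ + E i) = w ℓ + 1 ∨
      ¬ (DeltaBarI G.S ℓ i).Nonempty ∧ w (ℓ + E i) = w ℓ - 1 := by
  obtain ⟨h₁, h₂⟩ := hw.2 ℓ hℓ i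
  tauto

/-- Increments of the weight do not decrease under translation by a semigroup element. -/
theorem IsWeight.shift {r : ℕ} {G : GoodSemigroup r} {w : Pt r → ℤ} (hw : IsWeight G w)
    {s a b : Pt r} (hs : s ∈ G.S) (ha : 0 ≤ a) (hab : a ≤ b) :
    w (a + s) - w a ≤ w (b + s) - w b := by
  refine le_of_unit_steps (fun ℓ => w (ℓ + s) - w ℓ) hab fun ℓ hℓ i _ => ?_
  have hℓ₀ : 0 ≤ ℓ := ha.trans hℓ
  have himp : (DeltaBarI G.S ℓ i).Nonempty → (DeltaBarI G.S (ℓ + s) i).Nonempty := by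
    rintro ⟨t, ht, hti, htj⟩
    exact ⟨t + s, G.add_mem t ht s hs, by simp [hti], fun j hj => by simpa using htj j hj⟩
  have h₁ := hw.step hℓ₀ i
  have h₂ := hw.step (add_nonneg hℓ₀ (G.nonneg s hs)) i
  rw [add_right_comm] at h₂
  grind

/-- Dual paths below a generalized local minimum: the increment of the weight along a step and
along the step reflected in `p / 2` have nonpositive sum. -/
theorem GLM.dual_path {r : ℕ} {G : GoodSemigroup r} {w : Pt r → ℤ} (hw : IsWeight G w)
    {p a b : Pt r} (hp : GLM w p) (ha : 0 ≤ a) (hab : a ≤ b) (hb : b ≤ p) :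
    w (p - a) - w a ≤ w (p - b) - w b := by
  refine le_of_unit_steps (fun ℓ => w (p - ℓ) - w ℓ) hab fun ℓ hℓ i hi => ?_
  have hℓ₀ : 0 ≤ ℓ := ha.trans hℓ
  have hip : ℓ + E i ≤ p := hi.trans hb
  have hpi : 1 ≤ p i := by
    have h₁ := hip i
    have h₂ := hℓ₀ i
    simp only [Pi.add_apply, E_same, Pi.zero_apply] at h₁ h₂
    linarith
  have hpE : 0 ≤ p - E i :=
    sub_nonneg.2 ((le_add_of_nonneg_left hℓ₀).trans hip)
  have hnot : (DeltaBarI G.S ℓ i).Nonempty → ¬ (DeltaBarI G.S (p - (ℓ + E i)) i).Nonempty := by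
    rintro ⟨s, hs, hsi, hsj⟩ ⟨t, ht, hti, htj⟩
    have hne : (DeltaBarI G.S (p - E i) i).Nonempty := by
      refine ⟨s + t, G.add_mem s hs t ht, ?_, fun j hj => ?_⟩
      · simp only [Pi.add_apply, Pi.sub_apply] at hti ⊢
        linarith
      · have h₁ := hsj j hj
        have h₂ := htj j hj
        simp only [Pi.add_apply, Pi.sub_apply] at h₂ ⊢
        linarith
    have hup := ((hw.2 _ hpE i).1).2 hne
    rw [sub_add_cancel] at hup
    have := hp.2 i hpi
    linarith
  have h₁ := hw.step hℓ₀ i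
  have h₂ := hw.step (sub_nonneg.2 hip) i
  rw [← sub_sub, sub_add_cancel, sub_sub] at h₂
  grind

/-- A local minimum is reflected by the symmetry of the weight to a generalized local minimum. -/
theorem LocMin.glm_reflect {r : ℕ} {w : Pt r → ℤ} {c p : Pt r}
    (hsym : ∀ ℓ : Pt r, 0 ≤ ℓ → ℓ ≤ c → w (c - ℓ) = w ℓ) (hp : LocMin w p) (hpc : p ≤ c) :
    GLM w (c - p) := by
  refine ⟨sub_nonneg.2 hpc, fun i hi => ?_⟩
  have hle : p + E i ≤ c := add_E_le hpc (by simp only [Pi.sub_apply] at hi; linarith)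
  rw [sub_sub, hsym _ hp.1.1 hpc, hsym _ (add_nonneg hp.1.1 (E_nonneg i)) hle]
  exact hp.2 i

/-- If `m ≤ p - m`, the weight at `p - m` is at most the weight at `m`. -/
theorem GLM.weight_sub_le {r : ℕ} {G : GoodSemigroup r} {w : Pt r → ℤ} (hw : IsWeight G w)
    {p m : Pt r} (hp : GLM w p) (hm : 0 ≤ m) (hmp : m + m ≤ p) : w (p - m) ≤ w m := by
  have h := hp.dual_path hw hm (le_sub_iff_add_le.2 hmp) (sub_le_self p hm)
  rw [sub_sub_cancel] at h
  linarith

/-- in the Gorenstein (symmetric) case, any local minimum `p ∈ S`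
with `2m ≤ p ≤ c − 2m` satisfies `w(p) ≤ w(m)`. -/
theorem stmt15 {r : ℕ} (G : GoodSemigroup r) (w : Pt r → ℤ) (hw : IsWeight G w)
    (hsym : ∀ ℓ : Pt r, 0 ≤ ℓ → ℓ ≤ G.c → w (G.c - ℓ) = w ℓ)
    (m : Pt r) (hm : m ∈ G.S) (hmne : m ≠ 0)
    (hmmin : ∀ s ∈ G.S, s ≠ 0 → m ≤ s)
    (p : Pt r) (hpS : p ∈ G.S) (hlm : LocMin w p)
    (h1 : m + m ≤ p) (h2 : p ≤ G.c - (m + m)) :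
    w p ≤ w m := by
  have hm₀ := G.nonneg m hm
  have hpm : p + m + m ≤ G.c := by
    rw [add_assoc]
    exact le_sub_iff_add_le.1 h2
  have hpc₁ : p + m ≤ G.c := (le_add_of_nonneg_right hm₀).trans hpm
  have hpc : p ≤ G.c := (le_add_of_nonneg_right hm₀).trans hpc₁
  have hlow : w (p - m) ≤ w m := hlm.1.weight_sub_le hw hm₀ h1
  have hhigh : w (p + m) ≤ w m := by
    rw [← hsym _ (add_nonneg hlm.1.1 hm₀) hpc₁, ← sub_sub]
    exact (hlm.glm_reflect hsym hpc).weight_sub_le hw hm₀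
      (le_sub_iff_add_le'.2 (by rwa [← add_assoc]))
  have hmp : 0 ≤ p - m := sub_nonneg.2 ((le_add_of_nonneg_right hm₀).trans h1)
  have hconv := hw.shift hm hmp (sub_le_self p hm₀)
  rw [sub_add_cancel] at hconv
  linarith
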